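/- Let T be the n×n real symmetric tridiagonal matrix with diagonal entries a_1,…,a_n and off-diagonal entries b_2,…,b_n, let β ∈ ℝ, and let c ∈ ℝ. Assume θ_n = det T ≠ 0, θ_n + g_n(c) = det(T + cI) ≠ 0, and φ_{i+1} ≠ 0 for a given index i with 1 ≤ i ≤ n. Let z be the solution of T z = β e_1 and z^{(c)} the solution of (T + cI) z^{(c)} = β e_1. Then z^{(c)}_i = γ_i(c) · z_i, where the Lanczos filter γ_i(c) is defined by γ_i(c) = 1 − (g_n(c) φ_{i+1} − h_{i+1}(c) θ_n) / (φ_{i+1} (θ_n + g_n(c))). -/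

import Mathlib

/-- Explicit row sums of a tridiagonal matrix. -/
lemma tri_row (n : ℕ) (a b f : ℕ → ℝ) (i : ℕ) (hi : i < n) :
    ∑ j ∈ Finset.range n, (if i = j then a (i + 1)
      else if i + 1 = j then b (j + 1)
      else if j + 1 = i then b (i + 1)
      else 0) * f j
    = a (i + 1) * f i + (if i + 1 < n then b (i + 2) * f (i + 1) else 0)
      + (if 0 < i then b (i + 1) * f (i - 1) else 0) := by
  have key : ∀ j, (if i = j then a (i + 1)
      else if i + 1 = j then b (j + 1)
      else if j + 1 = i then b (i + 1)
      else 0) * f j = (if i = j then a (i + 1) * f j else 0)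
        + (if i + 1 = j then b (j + 1) * f j else 0)
        + (if i - 1 = j then (if 0 < i then b (i + 1) * f j else 0) else 0) := by
    intro j
    by_cases h1 : i = j
    · have h2 : ¬ i + 1 = j := by omega
      by_cases h3 : 0 < i
      · have h4 : ¬ i - 1 = j := by omega
        rw [if_pos h1, if_pos h1, if_neg h2, if_neg h4]; ring
      · rw [if_pos h1, if_pos h1, if_neg h2, if_neg h3]; simp
    · by_cases h2 : i + 1 = j
      · have h4 : ¬ i - 1 = j := by omega
        rw [if_neg h1, if_neg h1, if_pos h2, if_pos h2, if_neg h4]; ring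
      · by_cases h3 : j + 1 = i
        · have h4 : i - 1 = j := by omega
          have h5 : 0 < i := by omega
          rw [if_neg h1, if_neg h1, if_neg h2, if_neg h2, if_pos h3, if_pos h4, if_pos h5]; ring
        · have h4 : ¬ i - 1 = j := by omega
          rw [if_neg h1, if_neg h1, if_neg h2, if_neg h2, if_neg h3, if_neg h4]; ring
  rw [Finset.sum_congr rfl (fun j _ => key j), Finset.sum_add_distrib, Finset.sum_add_distrib,
    Finset.sum_ite_eq, Finset.sum_ite_eq, Finset.sum_ite_eq]
  have h6 : i - 1 < n := by omega
  simp only [Finset.mem_range, hi, h6, if_true]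

/-- The two continuant recurrences give the same determinant. -/
lemma phi_one_eq (n : ℕ) (hn : 1 ≤ n) (a b : ℕ → ℝ)
    (θ : ℕ → ℝ) (hθ0 : θ 0 = 1) (hθ1 : θ 1 = a 1)
    (hθ : ∀ ℓ, 2 ≤ ℓ → ℓ ≤ n → θ ℓ = a ℓ * θ (ℓ - 1) - (b ℓ) ^ 2 * θ (ℓ - 2))
    (φ : ℕ → ℝ) (hφtop : φ (n + 1) = 1) (hφn : φ n = a n)
    (hφ : ∀ ℓ, 1 ≤ ℓ → ℓ ≤ n - 1 → φ ℓ = a ℓ * φ (ℓ + 1) - (b (ℓ + 1)) ^ 2 * φ (ℓ + 2)) :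
    φ 1 = θ n := by
  have step : ∀ k, k + 2 ≤ n →
      φ 1 = θ (k + 1) * φ (k + 2) - (b (k + 2)) ^ 2 * θ k * φ (k + 3) := by
    intro k
    induction k with
    | zero =>
      intro hk
      rw [hφ 1 (by omega) (by omega), hθ0, hθ1]
      ring
    | succ k ih =>
      intro hk
      rw [ih (by omega), hφ (k + 2) (by omega) (by omega), hθ (k + 1 + 1) (by omega) (by omega)]
      simp only [show k + 1 + 1 - 1 = k + 1 by omega, show k + 1 + 1 - 2 = k by omega]
      ring_nf
  rcases Nat.lt_or_ge n 2 with h | h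
  · obtain rfl : n = 1 := by omega
    rw [hφn, hθ1]
  · obtain ⟨m, rfl⟩ : ∃ m, n = m + 2 := ⟨n - 2, by omega⟩
    rw [step m le_rfl, hθ (m + 2) (by omega) le_rfl, hφn, hφtop]
    simp only [show m + 2 - 1 = m + 1 by omega, show m + 2 - 2 = m by omega]
    ring

/-- Explicit solution of the tridiagonal system. -/
lemma tri_solve (n : ℕ) (hn : 1 ≤ n) (h0 : 0 < n) (a b : ℕ → ℝ)
    (T : Matrix (Fin n) (Fin n) ℝ)
    (hT : ∀ i j : Fin n, T i j =
      if (i : ℕ) = (j : ℕ) then a ((i : ℕ) + 1)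
      else if (i : ℕ) + 1 = (j : ℕ) then b ((j : ℕ) + 1)
      else if (j : ℕ) + 1 = (i : ℕ) then b ((i : ℕ) + 1)
      else 0)
    (θ : ℕ → ℝ) (hθ0 : θ 0 = 1) (hθ1 : θ 1 = a 1)
    (hθ : ∀ ℓ, 2 ≤ ℓ → ℓ ≤ n → θ ℓ = a ℓ * θ (ℓ - 1) - (b ℓ) ^ 2 * θ (ℓ - 2))
    (φ : ℕ → ℝ) (hφtop : φ (n + 1) = 1) (hφn : φ n = a n)
    (hφ : ∀ ℓ, 1 ≤ ℓ → ℓ ≤ n - 1 → φ ℓ = a ℓ * φ (ℓ + 1) - (b (ℓ + 1)) ^ 2 * φ (ℓ + 2))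
    (hdet : T.det ≠ 0)
    (β : ℝ) (i : Fin n) (z : Fin n → ℝ)
    (hz : T.mulVec z = β • (Pi.single (⟨0, h0⟩ : Fin n) (1 : ℝ) : Fin n → ℝ)) :
    θ n * z i = β * (∏ m ∈ Finset.range (i : ℕ), (- b (m + 2))) * φ ((i : ℕ) + 2) := by
  have h1 := phi_one_eq n hn a b θ hθ0 hθ1 hθ φ hφtop hφn hφ
  let f : ℕ → ℝ := fun k => β * (∏ m ∈ Finset.range k, (- b (m + 2))) * φ (k + 2)
  have hw : T.mulVec (fun k : Fin n => f k) = T.mulVec (θ n • z) := by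
    rw [Matrix.mulVec_smul, hz]
    funext k
    have e : T.mulVec (fun k : Fin n => f k) k = ∑ j ∈ Finset.range n, (if (k : ℕ) = j then a ((k : ℕ) + 1)
      else if (k : ℕ) + 1 = j then b (j + 1)
      else if j + 1 = (k : ℕ) then b ((k : ℕ) + 1)
      else 0) * f j := by
      rw [← Fin.sum_univ_eq_sum_range (fun j => (if (k : ℕ) = j then a ((k : ℕ) + 1)
      else if (k : ℕ) + 1 = j then b (j + 1)
      else if j + 1 = (k : ℕ) then b ((k : ℕ) + 1)
      else 0) * f j)]
      simp only [Matrix.mulVec, dotProduct, hT]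
    rw [e, tri_row n a b f k k.2]
    -- the combined first two terms
    have e2 : a ((k : ℕ) + 1) * f k + (if (k : ℕ) + 1 < n then b (k + 2) * f (k + 1) else 0)
        = β * (∏ m ∈ Finset.range (k : ℕ), (- b (m + 2))) * φ ((k : ℕ) + 1) := by
      by_cases hk : (k : ℕ) + 1 < n
      · rw [if_pos hk, hφ (k + 1) (by omega) (by omega)]
        simp only [f, Finset.prod_range_succ]
        ring_nf
      · have hk' : (k : ℕ) + 1 = n := by have := k.2; omega
        rw [if_neg hk]
        simp only [f]
        rw [show (k : ℕ) + 2 = n + 1 by omega, hk', hφtop, hφn]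
        ring
    rw [e2]
    obtain ⟨k, hkn⟩ := k
    cases k with
    | zero => simp [h1]; ring
    | succ k =>
      have : (⟨k + 1, hkn⟩ : Fin n) ≠ ⟨0, h0⟩ := by simp
      simp [f, Finset.prod_range_succ]
      ring
  have hinj := Matrix.mulVec_injective_of_isUnit
    ((Matrix.isUnit_iff_isUnit_det T).2 (isUnit_iff_ne_zero.2 hdet))
  have := congrFun (hinj hw) i
  simp only [Pi.smul_apply, smul_eq_mul] at this
  exact this.symm


/-- the Lanczos filter relation `z⁽ᶜ⁾ᵢ = γᵢ(c) · zᵢ` between the solutions of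
the tridiagonal system and its shifted version. -/
theorem stmt_10 (n : ℕ) (hn : 1 ≤ n) (a b : ℕ → ℝ) (c : ℝ)
    (T : Matrix (Fin n) (Fin n) ℝ)
    (hT : ∀ i j : Fin n, T i j =
      if (i : ℕ) = (j : ℕ) then a ((i : ℕ) + 1)
      else if (i : ℕ) + 1 = (j : ℕ) then b ((j : ℕ) + 1)
      else if (j : ℕ) + 1 = (i : ℕ) then b ((i : ℕ) + 1)
      else 0)
    (θ : ℕ → ℝ) (hθ0 : θ 0 = 1) (hθ1 : θ 1 = a 1)
    (hθ : ∀ ℓ, 2 ≤ ℓ → ℓ ≤ n → θ ℓ = a ℓ * θ (ℓ - 1) - (b ℓ) ^ 2 * θ (ℓ - 2))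
    (φ : ℕ → ℝ) (hφtop : φ (n + 1) = 1) (hφn : φ n = a n)
    (hφ : ∀ ℓ, 1 ≤ ℓ → ℓ ≤ n - 1 → φ ℓ = a ℓ * φ (ℓ + 1) - (b (ℓ + 1)) ^ 2 * φ (ℓ + 2))
    (g : ℕ → ℝ) (hg0 : g 0 = 0) (hg1 : g 1 = c)
    (hg : ∀ ℓ, 2 ≤ ℓ → ℓ ≤ n →
      g ℓ = (a ℓ + c) * g (ℓ - 1) - (b ℓ) ^ 2 * g (ℓ - 2) + c * θ (ℓ - 1))
    (h : ℕ → ℝ) (hhtop : h (n + 1) = 0) (hhn : h n = c)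
    (hh : ∀ ℓ, 1 ≤ ℓ → ℓ ≤ n - 1 →
      h ℓ = (a ℓ + c) * h (ℓ + 1) - (b (ℓ + 1)) ^ 2 * h (ℓ + 2) + c * φ (ℓ + 1))
    (hθn : θ n = T.det) (hθn0 : θ n ≠ 0)
    (hgn : θ n + g n = (T + c • (1 : Matrix (Fin n) (Fin n) ℝ)).det)
    (hgn0 : θ n + g n ≠ 0)
    (β : ℝ) (i : Fin n) (hφi : φ ((i : ℕ) + 2) ≠ 0)
    (z : Fin n → ℝ)
    (hz : T.mulVec z = β • (Pi.single (⟨0, by omega⟩ : Fin n) (1 : ℝ) : Fin n → ℝ))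
    (zc : Fin n → ℝ)
    (hzc : (T + c • (1 : Matrix (Fin n) (Fin n) ℝ)).mulVec zc =
      β • (Pi.single (⟨0, by omega⟩ : Fin n) (1 : ℝ) : Fin n → ℝ)) :
    zc i =
      (1 - (g n * φ ((i : ℕ) + 2) - h ((i : ℕ) + 2) * θ n) /
        (φ ((i : ℕ) + 2) * (θ n + g n))) * z i := by
  have A := tri_solve n hn hn a b T hT θ hθ0 hθ1 hθ φ hφtop hφn hφ (hθn ▸ hθn0) β i z hz
  have B := tri_solve n hn hn (fun k => a k + c) b (T + c • (1 : Matrix (Fin n) (Fin n) ℝ))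
    (by
      intro i j
      rw [Matrix.add_apply, Matrix.smul_apply, hT, Matrix.one_apply]
      by_cases hij : i = j
      · simp [hij]
      · have : ¬ (i : ℕ) = (j : ℕ) := fun h => hij (Fin.ext h)
        simp [hij, this])
    (fun k => θ k + g k) (by simp [hθ0, hg0]) (by simp [hθ1, hg1])
    (by
      intro l h1 h2
      rw [hθ l h1 h2, hg l h1 h2]; ring)
    (fun k => φ k + h k) (by simp [hφtop, hhtop]) (by simp [hφn, hhn])
    (by
      intro l h1 h2
      rw [hφ l h1 h2, hh l h1 h2]; ring)
    (hgn ▸ hgn0) β i zc hzc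
  have hz' := (eq_div_iff hθn0).2 ((mul_comm _ _).trans A)
  have hzc' := (eq_div_iff hgn0).2 ((mul_comm _ _).trans B)
  rw [hz', hzc']
  field_simp
  ring
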